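/- For every real s > 0, the function s ↦ I₃(s) - I₁(s) is differentiable at s and its derivative equals -(3/4)·I₁(s) - (1/4)·I₀(s). -/

import Mathlib

open Real

/-- `I_ν(s) = (1/√2) ∫₋₁¹ tᵛ/(√(t+1)√(t²+s)) dt`. -/
noncomputable def Inu (ν : ℕ) (s : ℝ) : ℝ :=
  (1 / Real.sqrt 2) * ∫ t in (-1 : ℝ)..1, t ^ ν / (Real.sqrt (t + 1) * Real.sqrt (t ^ 2 + s))

open MeasureTheory Set

lemma intervalIntegrable_inv_sqrt_add_one :
    IntervalIntegrable (fun t : ℝ => (√(t + 1))⁻¹) volume (-1) 1 := by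
  have h : IntervalIntegrable (fun t : ℝ => t ^ (-(1 / 2) : ℝ)) volume 0 2 :=
    intervalIntegral.intervalIntegrable_rpow' (by norm_num)
  have h2 := h.comp_add_right 1
  norm_num at h2
  refine h2.congr fun t ht => ?_
  rw [uIoc_of_le (by norm_num)] at ht
  rw [Real.rpow_neg (by linarith [ht.1]), Real.sqrt_eq_rpow]

lemma intervalIntegrable_inv_sqrt_add_one_mul {f : ℝ → ℝ} (hf : Continuous f) :
    IntervalIntegrable (fun t : ℝ => (√(t + 1))⁻¹ * f t) volume (-1) 1 :=
  intervalIntegrable_inv_sqrt_add_one.mul_continuousOn hf.continuousOn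

lemma intervalIntegrable_Inu_integrand (ν : ℕ) {s : ℝ} (hs : 0 < s) :
    IntervalIntegrable (fun t : ℝ => t ^ ν / (√(t + 1) * √(t ^ 2 + s))) volume (-1) 1 := by
  have hc : Continuous fun t : ℝ => t ^ ν / √(t ^ 2 + s) :=
    Continuous.div (by fun_prop) (by fun_prop) fun t => by positivity
  convert intervalIntegrable_inv_sqrt_add_one_mul hc using 2 with t
  simp only [div_eq_mul_inv, mul_inv]
  ring

lemma hasDerivAt_inv_sqrt_sq_add {t x : ℝ} (hx : 0 < x) :
    HasDerivAt (fun x => (√(t ^ 2 + x))⁻¹) (-(1 / 2) * ((t ^ 2 + x) * √(t ^ 2 + x))⁻¹) x := by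
  have hp : 0 < t ^ 2 + x := by positivity
  have h := (((hasDerivAt_id x).const_add (t ^ 2)).sqrt hp.ne').inv (Real.sqrt_pos.2 hp).ne'
  simp only [id, Real.sq_sqrt hp.le] at h
  refine h.congr_deriv ?_
  field_simp

/-- Differentiation under the integral sign. -/
lemma hasDerivAt_integral_Inu (ν : ℕ) {s : ℝ} (hs : 0 < s) :
    IntervalIntegrable (fun t : ℝ => t ^ ν / √(t + 1) *
      (-(1 / 2) * ((t ^ 2 + s) * √(t ^ 2 + s))⁻¹)) volume (-1) 1 ∧
    HasDerivAt (fun x => ∫ t in (-1 : ℝ)..1, t ^ ν / (√(t + 1) * √(t ^ 2 + x)))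
      (∫ t in (-1 : ℝ)..1, t ^ ν / √(t + 1) *
        (-(1 / 2) * ((t ^ 2 + s) * √(t ^ 2 + s))⁻¹)) s := by
  refine intervalIntegral.hasDerivAt_integral_of_dominated_loc_of_deriv_le
    (F' := fun x t => t ^ ν / √(t + 1) * (-(1 / 2) * ((t ^ 2 + x) * √(t ^ 2 + x))⁻¹))
    (bound := fun t => (√(t + 1))⁻¹ * (s / 2 * √(s / 2))⁻¹)
    (Ioi_mem_nhds (half_lt_self hs)) ?_ (intervalIntegrable_Inu_integrand ν hs) ?_ ?_
    (intervalIntegrable_inv_sqrt_add_one_mul continuous_const) ?_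
  · exact .of_forall fun x => Measurable.aestronglyMeasurable (by fun_prop)
  · exact Measurable.aestronglyMeasurable (by fun_prop)
  · refine .of_forall fun t ht x hx => ?_
    rw [uIoc_of_le (by norm_num)] at ht
    have hx : s / 2 < x := hx
    have hx0 : 0 < x := by linarith
    have hle : s / 2 ≤ t ^ 2 + x := by nlinarith [sq_nonneg t]
    have ht1 : |t| ^ ν ≤ 1 := pow_le_one₀ (abs_nonneg t) (abs_le.2 ⟨ht.1.le, ht.2⟩)
    have hinv : ((t ^ 2 + x) * √(t ^ 2 + x))⁻¹ ≤ (s / 2 * √(s / 2))⁻¹ := by gcongr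
    have hnn : 0 ≤ ((t ^ 2 + x) * √(t ^ 2 + x))⁻¹ := by positivity
    rw [Real.norm_eq_abs, abs_mul, abs_div, abs_mul, abs_pow, abs_of_nonneg hnn,
      abs_of_nonneg (Real.sqrt_nonneg (t + 1)), div_eq_mul_inv]
    have habs : |(-(1 / 2) : ℝ)| = 1 / 2 := by norm_num
    rw [habs]
    have hw : 0 ≤ (√(t + 1))⁻¹ := by positivity
    apply mul_le_mul (mul_le_of_le_one_left hw ht1) (by linarith) (by positivity) hw
  · refine .of_forall fun t _ x hx => ?_
    have hx0 : 0 < x := (half_pos hs).trans hx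
    have heq : (fun x => t ^ ν / (√(t + 1) * √(t ^ 2 + x))) =
        fun x => t ^ ν / √(t + 1) * (√(t ^ 2 + x))⁻¹ := by
      funext y
      simp only [div_eq_mul_inv, mul_inv, mul_assoc]
    rw [heq]
    exact (hasDerivAt_inv_sqrt_sq_add hx0).const_mul _

lemma hasDerivAt_sub_one_mul_sqrt_div_sqrt {s t : ℝ} (hs : 0 < s) (ht : -1 < t) :
    HasDerivAt (fun t => (t - 1) * √(t + 1) / √(t ^ 2 + s))
      ((3 / 2) * (t ^ 1 / (√(t + 1) * √(t ^ 2 + s))) +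
        (1 / 2) * (t ^ 0 / (√(t + 1) * √(t ^ 2 + s))) +
        2 * (t ^ 3 / √(t + 1) * (-(1 / 2) * ((t ^ 2 + s) * √(t ^ 2 + s))⁻¹) -
          t ^ 1 / √(t + 1) * (-(1 / 2) * ((t ^ 2 + s) * √(t ^ 2 + s))⁻¹))) t := by
  have hp : 0 < t + 1 := by linarith
  have hq : 0 < t ^ 2 + s := by positivity
  have hsp := Real.sqrt_pos.2 hp
  have hsq := Real.sqrt_pos.2 hq
  have h := (((hasDerivAt_id t).sub_const 1).mul
    (((hasDerivAt_id t).add_const 1).sqrt hp.ne')).div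
    ((((hasDerivAt_id t).pow 2).add_const s).sqrt hq.ne') hsq.ne'
  refine h.congr_deriv ?_
  simp only [id, Pi.mul_apply, Pi.pow_apply]
  have e1 : √(t + 1) ^ 2 = t + 1 := Real.sq_sqrt hp.le
  have e2 : √(t ^ 2 + s) ^ 2 = t ^ 2 + s := Real.sq_sqrt hq.le
  generalize √(t + 1) = a at *
  generalize √(t ^ 2 + s) = b at *
  rw [← e2]
  obtain rfl : t = a ^ 2 - 1 := by linarith
  field_simp
  ring

theorem stmt12 (s : ℝ) (hs : 0 < s) :
    HasDerivAt (fun x => Inu 3 x - Inu 1 x)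
      (-(3 / 4) * Inu 1 s - (1 / 4) * Inu 0 s) s := by
  obtain ⟨i3, d3⟩ := hasDerivAt_integral_Inu 3 hs
  obtain ⟨i1, d1⟩ := hasDerivAt_integral_Inu 1 hs
  have j1 := intervalIntegrable_Inu_integrand 1 hs
  have j0 := intervalIntegrable_Inu_integrand 0 hs
  refine ((d3.const_mul (1 / √2)).sub (d1.const_mul (1 / √2))).congr_deriv ?_
  have hcont : Continuous fun t : ℝ => (t - 1) * √(t + 1) / √(t ^ 2 + s) :=
    Continuous.div (by fun_prop) (by fun_prop) fun t => by positivity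
  have key := intervalIntegral.integral_eq_sub_of_hasDerivAt_of_le (by norm_num)
    hcont.continuousOn (fun t ht => hasDerivAt_sub_one_mul_sqrt_div_sqrt hs ht.1)
    (((j1.const_mul (3 / 2)).add (j0.const_mul (1 / 2))).add ((i3.sub i1).const_mul 2))
  rw [intervalIntegral.integral_add ((j1.const_mul (3 / 2)).add (j0.const_mul (1 / 2)))
      ((i3.sub i1).const_mul 2),
    intervalIntegral.integral_add (j1.const_mul (3 / 2)) (j0.const_mul (1 / 2)),
    intervalIntegral.integral_const_mul, intervalIntegral.integral_const_mul,
    intervalIntegral.integral_const_mul, intervalIntegral.integral_sub i3 i1] at key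
  norm_num only [sub_self, neg_add_cancel, Real.sqrt_zero, mul_zero, zero_mul, zero_div] at key
  unfold Inu
  linear_combination (1 / √2) / 2 * key
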